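/- arXiv:2507.19462 — 3 statements merged into one kernel-verified Lean document; each statement's English description precedes it below -/
import Mathlib

section
/- Let n and d be positive integers with d ∣ n. The set of matrices M in B(n) whose reduction modulo d is the identity matrix (that is, the kernel of the entrywise reduction homomorphism B(n) → B(d)) has cardinality (φ(n) · n · φ(n)) / (φ(d) · d · φ(d)); equivalently, its cardinality c satisfies c · φ(d)² · d = φ(n)² · n. -/
open Matrix

/-- The invertible upper-triangular matrix with diagonal entries `a`, `c` and upper-right
entry `b`. -/
noncomputable def upperTriangularGL {R : Type*} [CommRing R] (a : Rˣ) (b : R) (c : Rˣ) :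
    GL (Fin 2) R :=
  Matrix.GeneralLinearGroup.mk'' !![(a : R), b; 0, (c : R)] (by
    rw [Matrix.det_fin_two_of, mul_zero, sub_zero]
    exact a.isUnit.mul c.isUnit)

lemma coe_upperTriangularGL {R : Type*} [CommRing R] (a : Rˣ) (b : R) (c : Rˣ) :
    (upperTriangularGL a b c : Matrix (Fin 2) (Fin 2) R) = !![(a : R), b; 0, (c : R)] :=
  rfl

lemma exists_eq_upperTriangularGL {R : Type*} [CommRing R] (M : GL (Fin 2) R)
    (h : (M : Matrix (Fin 2) (Fin 2) R) 1 0 = 0) : ∃ a b c, upperTriangularGL a b c = M := by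
  have hdet : IsUnit (M : Matrix (Fin 2) (Fin 2) R).det :=
    (Matrix.isUnit_iff_isUnit_det _).1 M.isUnit
  rw [Matrix.det_fin_two, h, mul_zero, sub_zero] at hdet
  obtain ⟨⟨a, ha⟩, ⟨c, hc⟩⟩ := IsUnit.mul_iff.1 hdet
  refine ⟨a, (M : Matrix (Fin 2) (Fin 2) R) 0 1, c, Units.ext ?_⟩
  ext i j
  fin_cases i <;> fin_cases j <;> simp [coe_upperTriangularGL, ha, hc, h]

lemma map_upperTriangularGL_eq_one_iff {R S : Type*} [CommRing R] [CommRing S] (f : R →+* S)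
    (a : Rˣ) (b : R) (c : Rˣ) :
    Matrix.GeneralLinearGroup.map (n := Fin 2) f (upperTriangularGL a b c) = 1 ↔
      a ∈ (Units.map (f : R →* S)).ker ∧ b ∈ (f : R →+ S).ker ∧
        c ∈ (Units.map (f : R →* S)).ker := by
  simp only [MonoidHom.mem_ker, AddMonoidHom.mem_ker, Units.ext_iff, ← Matrix.ext_iff,
    Fin.forall_fin_two, Matrix.GeneralLinearGroup.map_apply, coe_upperTriangularGL]
  simp [and_assoc]

/-- The kernel of the map induced by a ring homomorphism on invertible upper-triangular
matrices is counted entrywise. -/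
lemma card_ker_map_upperTriangularGL {R S : Type*} [CommRing R] [CommRing S] (f : R →+* S) :
    Nat.card {M : GL (Fin 2) R // (M : Matrix (Fin 2) (Fin 2) R) 1 0 = 0 ∧
        Matrix.GeneralLinearGroup.map (n := Fin 2) f M = 1} =
      Nat.card (Units.map (f : R →* S)).ker *
        (Nat.card (f : R →+ S).ker * Nat.card (Units.map (f : R →* S)).ker) := by
  rw [← Nat.card_prod, ← Nat.card_prod]
  symm
  refine Nat.card_eq_of_bijective (fun x ↦ ⟨upperTriangularGL x.1.1 x.2.1.1 x.2.2.1, rfl,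
    (map_upperTriangularGL_eq_one_iff f _ _ _).2 ⟨x.1.2, x.2.1.2, x.2.2.2⟩⟩) ⟨?_, ?_⟩
  · rintro ⟨⟨a, _⟩, ⟨b, _⟩, ⟨c, _⟩⟩ ⟨⟨a', _⟩, ⟨b', _⟩, ⟨c', _⟩⟩ h
    have h := congrArg (fun M ↦ (M.1 : Matrix (Fin 2) (Fin 2) R)) h
    simp only [coe_upperTriangularGL, ← Matrix.ext_iff, Fin.forall_fin_two] at h
    simpa [Units.ext_iff, and_assoc] using h
  · rintro ⟨M, h, hM⟩
    obtain ⟨a, b, c, rfl⟩ := exists_eq_upperTriangularGL M h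
    obtain ⟨ha, hb, hc⟩ := (map_upperTriangularGL_eq_one_iff f a b c).1 hM
    exact ⟨⟨⟨a, ha⟩, ⟨b, hb⟩, ⟨c, hc⟩⟩, rfl⟩

@[to_additive]
lemma MonoidHom.natCard_ker_of_surjective {G H : Type*} [Group G] [Group H] (f : G →* H)
    (hf : Function.Surjective f) : Nat.card f.ker * Nat.card H = Nat.card G := by
  rw [← f.ker.card_mul_index, Subgroup.index_ker, MonoidHom.range_eq_top.2 hf,
    Subgroup.card_top]

/-- For positive integers `d ∣ n`, the set of upper-triangular matrices `M ∈ B(n) ≤ GL₂(ℤ/nℤ)`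
whose entrywise reduction modulo `d` is the identity (the kernel of `B(n) → B(d)`) has
cardinality `(φ(n)·n·φ(n)) / (φ(d)·d·φ(d))`; equivalently, its cardinality `c` satisfies
`c * φ(d)² * d = φ(n)² * n`. -/
theorem card_ker_reduction_upperTriangular (n d : ℕ) (hn : 0 < n) (hd : 0 < d) (hdn : d ∣ n) :
    Nat.card {M : GL (Fin 2) (ZMod n) //
        (M : Matrix (Fin 2) (Fin 2) (ZMod n)) 1 0 = 0 ∧
        Matrix.GeneralLinearGroup.map (n := Fin 2) (ZMod.castHom hdn (ZMod d)) M = 1} =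
      (n.totient * n * n.totient) / (d.totient * d * d.totient) ∧
    Nat.card {M : GL (Fin 2) (ZMod n) //
        (M : Matrix (Fin 2) (Fin 2) (ZMod n)) 1 0 = 0 ∧
        Matrix.GeneralLinearGroup.map (n := Fin 2) (ZMod.castHom hdn (ZMod d)) M = 1} *
      (d.totient ^ 2 * d) = n.totient ^ 2 * n := by
  have : NeZero n := ⟨hn.ne'⟩
  have : NeZero d := ⟨hd.ne'⟩
  have hu : Nat.card (Units.map (ZMod.castHom hdn (ZMod d) : ZMod n →* ZMod d)).ker *
      d.totient = n.totient := by
    have h := MonoidHom.natCard_ker_of_surjective _ (ZMod.unitsMap_surjective hdn)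
    rwa [Nat.card_eq_fintype_card (α := (ZMod d)ˣ), Nat.card_eq_fintype_card (α := (ZMod n)ˣ),
      ZMod.card_units_eq_totient, ZMod.card_units_eq_totient] at h
  have ha : Nat.card (ZMod.castHom hdn (ZMod d) : ZMod n →+ ZMod d).ker * d = n := by
    have h := AddMonoidHom.natCard_ker_of_surjective
      (ZMod.castHom hdn (ZMod d) : ZMod n →+ ZMod d) (ZMod.castHom_surjective hdn)
    rwa [Nat.card_zmod, Nat.card_zmod] at h
  have hφ : 0 < d.totient := Nat.totient_pos.2 hd
  rw [card_ker_map_upperTriangularGL]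
  generalize Nat.card (Units.map (ZMod.castHom hdn (ZMod d) : ZMod n →* ZMod d)).ker = u at *
  generalize Nat.card (ZMod.castHom hdn (ZMod d) : ZMod n →+ ZMod d).ker = k at *
  constructor
  · refine (Nat.div_eq_of_eq_mul_left (by positivity) ?_).symm
    rw [← hu]
    linear_combination (u * d.totient) ^ 2 * ha.symm
  · rw [← hu]
    linear_combination (u * d.totient) ^ 2 * ha
end

section
/- Let ℓ be a prime, let a and s be positive integers with ℓ ∤ a, and set N = a·ℓ^s. Let P be an element of the abelian group (ℤ/Nℤ)² of exact additive order N. Then the number of elements Q ∈ (ℤ/Nℤ)² such that ℓ^s · Q = ℓ^s · P and Q has exact additive order N is (ℓ² − 1)·ℓ^{2s − 2}. -/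
/-- For `d ∣ N`, the group `(ℤ/Nℤ)²` has `d ^ 2` elements killed by `d`. -/
theorem ZMod.ncard_prod_nsmul_eq_zero {N d : ℕ} [NeZero N] (hd : d ∣ N) :
    {x : ZMod N × ZMod N | d • x = 0}.ncard = d ^ 2 := by
  have h : {x : ZMod N | d • x = 0}.ncard = d := by
    have h := IsAddCyclic.card_nsmulAddMonoidHom_ker (G := ZMod N) d
    rw [Nat.card_zmod, Nat.gcd_eq_right hd] at h
    exact h
  have hprod : {x : ZMod N × ZMod N | d • x = 0} =
      {x : ZMod N | d • x = 0} ×ˢ {x : ZMod N | d • x = 0} := by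
    ext ⟨x, y⟩
    simp only [Set.mem_ofPred_eq, Set.mem_prod, Prod.smul_mk, Prod.mk_eq_zero]
  rw [hprod, Set.ncard_prod, h, sq]

/-- The fibre of multiplication by `m` through `P` is a translate of the `m`-torsion. -/
theorem ncard_nsmul_eq_nsmul {G : Type*} [AddCommGroup G] (m : ℕ) (P : G) :
    {Q : G | m • Q = m • P}.ncard = {x : G | m • x = 0}.ncard := by
  rw [← Set.ncard_image_of_injective {x : G | m • x = 0} (add_left_injective P)]
  congr 1
  ext Q
  simp only [Set.mem_ofPred_eq, Set.mem_image]
  refine ⟨fun h => ⟨Q - P, by rw [nsmul_sub, h, sub_self], sub_add_cancel Q P⟩, ?_⟩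
  rintro ⟨x, hx, rfl⟩
  rw [nsmul_add, hx, zero_add]

/-- If `n` kills `Q₀`, the elements of the fibre of multiplication by `m` through `Q₀` that are
killed by `n` form a translate of the `gcd m n`-torsion. -/
theorem ncard_nsmul_eq_nsmul_and_nsmul_eq_zero {G : Type*} [AddCommGroup G] (m n : ℕ) {Q₀ : G}
    (hQ₀ : n • Q₀ = 0) :
    {Q : G | m • Q = m • Q₀ ∧ n • Q = 0}.ncard = {x : G | m.gcd n • x = 0}.ncard := by
  rw [← ncard_nsmul_eq_nsmul (m.gcd n) Q₀]
  congr 1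
  ext Q
  simp only [Set.mem_ofPred_eq]
  rw [← sub_eq_zero (b := m • Q₀), ← sub_eq_zero (b := m.gcd n • Q₀), ← nsmul_sub, ← nsmul_sub,
    gcd_nsmul_eq_zero, nsmul_sub Q Q₀ n, hQ₀, sub_zero]

/-- Let `ℓ` be a prime, `a, s` positive integers with `ℓ ∤ a`, and `N = a * ℓ^s`.
If `P ∈ (ℤ/Nℤ)²` has exact additive order `N`, then the number of `Q ∈ (ℤ/Nℤ)²` with
`ℓ^s • Q = ℓ^s • P` and `Q` of exact additive order `N` is `(ℓ² - 1) * ℓ^(2s - 2)`. -/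
theorem card_lifts_of_order (ℓ a s : ℕ) (hℓ : ℓ.Prime) (ha : 0 < a) (hs : 0 < s)
    (hla : ¬ ℓ ∣ a) (P : ZMod (a * ℓ ^ s) × ZMod (a * ℓ ^ s))
    (hP : addOrderOf P = a * ℓ ^ s) :
    Nat.card {Q : ZMod (a * ℓ ^ s) × ZMod (a * ℓ ^ s) //
        ℓ ^ s • Q = ℓ ^ s • P ∧ addOrderOf Q = a * ℓ ^ s} =
      (ℓ ^ 2 - 1) * ℓ ^ (2 * s - 2) := by
  obtain ⟨t, rfl⟩ : ∃ t, s = t + 1 := ⟨s - 1, by omega⟩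
  have hpos : 0 < a * ℓ ^ (t + 1) := Nat.mul_pos ha (pow_pos hℓ.pos _)
  have : NeZero (a * ℓ ^ (t + 1)) := ⟨hpos.ne'⟩
  have hcop : Nat.Coprime ℓ a := hℓ.coprime_iff_not_dvd.2 hla
  have hPa : addOrderOf (ℓ ^ (t + 1) • P) = a := by
    rw [addOrderOf_nsmul, hP, Nat.gcd_eq_right (Dvd.intro_left _ rfl),
      Nat.mul_div_cancel _ (pow_pos hℓ.pos _)]
  have hkill (Q : ZMod (a * ℓ ^ (t + 1)) × ZMod (a * ℓ ^ (t + 1))) :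
      (a * ℓ ^ (t + 1)) • Q = 0 := by
    ext <;> simp [nsmul_eq_mul, -Nat.cast_mul]
  have horder (Q : ZMod (a * ℓ ^ (t + 1)) × ZMod (a * ℓ ^ (t + 1)))
      (hQ : ℓ ^ (t + 1) • Q = ℓ ^ (t + 1) • P) :
      addOrderOf Q = a * ℓ ^ (t + 1) ↔ ¬ (a * ℓ ^ t) • Q = 0 := by
    rw [← addOrderOf_dvd_iff_nsmul_eq_zero]
    have hdvd : addOrderOf Q ∣ a * ℓ ^ (t + 1) := addOrderOf_dvd_of_nsmul_eq_zero (hkill Q)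
    have haQ : a ∣ addOrderOf Q := by
      conv_lhs => rw [← hPa, ← hQ]
      exact addOrderOf_smul_dvd _
    obtain ⟨c, hc⟩ := haQ
    rw [hc] at hdvd ⊢
    rw [Nat.mul_dvd_mul_iff_left ha] at hdvd ⊢
    rw [Nat.mul_right_inj ha.ne']
    constructor
    · rintro rfl h
      exact absurd ((Nat.pow_dvd_pow_iff_le_right hℓ.one_lt).1 h) (by omega)
    · intro h
      obtain ⟨k, hk, rfl⟩ := (Nat.dvd_prime_pow hℓ).1 hdvd
      rw [Nat.pow_dvd_pow_iff_le_right hℓ.one_lt] at h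
      congr 1
      omega
  obtain ⟨c, hc0, hc1⟩ := Nat.chineseRemainder hcop 0 1
  have hlc : ℓ ∣ c := (Nat.modEq_zero_iff_dvd).1 hc0
  have hmQ₀ : ℓ ^ (t + 1) • c • P = ℓ ^ (t + 1) • P := by
    rw [smul_comm]
    conv_rhs => rw [← one_nsmul (ℓ ^ (t + 1) • P)]
    rw [nsmul_eq_nsmul_iff_modEq, hPa]
    exact hc1
  have hnQ₀ : (a * ℓ ^ t) • c • P = 0 := by
    obtain ⟨k, rfl⟩ := hlc
    rw [← mul_nsmul', show a * ℓ ^ t * (ℓ * k) = k * (a * ℓ ^ (t + 1)) by ring, mul_nsmul', hkill,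
      nsmul_zero]
  have hgcd : (ℓ ^ (t + 1)).gcd (a * ℓ ^ t) = ℓ ^ t := by
    rw [pow_succ', Nat.gcd_mul_right, hcop.gcd_eq_one, one_mul]
  have hset : {Q | ℓ ^ (t + 1) • Q = ℓ ^ (t + 1) • P ∧ addOrderOf Q = a * ℓ ^ (t + 1)} =
      {Q | ℓ ^ (t + 1) • Q = ℓ ^ (t + 1) • P} \
        {Q | ℓ ^ (t + 1) • Q = ℓ ^ (t + 1) • c • P ∧ (a * ℓ ^ t) • Q = 0} := by
    ext Q
    simp only [Set.mem_ofPred_eq, Set.mem_sdiff, hmQ₀, not_and]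
    exact ⟨fun h => ⟨h.1, fun _ => (horder Q h.1).1 h.2⟩,
      fun h => ⟨h.1, (horder Q h.1).2 (h.2 h.1)⟩⟩
  change Set.ncard {Q | ℓ ^ (t + 1) • Q = ℓ ^ (t + 1) • P ∧ addOrderOf Q = a * ℓ ^ (t + 1)} = _
  rw [hset, Set.ncard_sdiff fun Q hQ => hQ.1.trans hmQ₀, ncard_nsmul_eq_nsmul,
    ncard_nsmul_eq_nsmul_and_nsmul_eq_zero _ _ hnQ₀, hgcd,
    ZMod.ncard_prod_nsmul_eq_zero (Dvd.intro_left _ rfl),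
    ZMod.ncard_prod_nsmul_eq_zero ((pow_dvd_pow ℓ t.le_succ).mul_left a), Nat.sub_mul,
    show 2 * (t + 1) - 2 = 2 * t by omega]
  congr 1 <;> ring
end

section
/- Let n be a positive integer. The index of the upper-triangular subgroup B(n) in GL₂(ℤ/nℤ) satisfies [GL₂(ℤ/nℤ) : B(n)] · ∏_{p prime, p ∣ n} p = n · ∏_{p prime, p ∣ n} (p + 1); equivalently, [GL₂(ℤ/nℤ) : B(n)] = n · ∏_{p ∣ n} (1 + 1/p), which equals the degree of the natural map X₀(n) → X₀(1). -/
open Matrix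

/-- The action of `GL₂(R)` on column vectors. -/
@[reducible] def columnAction (R : Type*) [CommRing R] : MulAction (GL (Fin 2) R) (Fin 2 → R) where
  smul M v := (M : Matrix (Fin 2) (Fin 2) R) *ᵥ v
  one_smul v := by
    change ((1 : GL (Fin 2) R) : Matrix (Fin 2) (Fin 2) R) *ᵥ v = v
    simp
  mul_smul M N v := by
    change ((M * N : GL (Fin 2) R) : Matrix (Fin 2) (Fin 2) R) *ᵥ v =
      (M : Matrix (Fin 2) (Fin 2) R) *ᵥ ((N : Matrix (Fin 2) (Fin 2) R) *ᵥ v)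
    rw [Matrix.mulVec_mulVec, Units.val_mul]

/-- The stabilizer of the first standard basis vector in `GL₂(R)`. -/
def firstColumnStabilizer (R : Type*) [CommRing R] : Subgroup (GL (Fin 2) R) :=
  letI := columnAction R
  MulAction.stabilizer (GL (Fin 2) R) (![1, 0] : Fin 2 → R)

theorem mulVec_one_zero {R : Type*} [CommRing R] (M : Matrix (Fin 2) (Fin 2) R) :
    M *ᵥ ![1, 0] = ![M 0 0, M 1 0] := by
  ext i
  fin_cases i <;> simp [Matrix.mulVec, dotProduct]

theorem mem_firstColumnStabilizer {R : Type*} [CommRing R] {M : GL (Fin 2) R} :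
    M ∈ firstColumnStabilizer R ↔
      (M : Matrix (Fin 2) (Fin 2) R) 0 0 = 1 ∧ (M : Matrix (Fin 2) (Fin 2) R) 1 0 = 0 := by
  change (M : Matrix (Fin 2) (Fin 2) R) *ᵥ ![1, 0] = ![1, 0] ↔ _
  rw [mulVec_one_zero]
  simp [funext_iff, Fin.forall_fin_two]

theorem index_firstColumnStabilizer (R : Type*) [CommRing R] :
    (firstColumnStabilizer R).index = Nat.card {v : R × R // IsCoprime v.1 v.2} := by
  let := columnAction R
  change (MulAction.stabilizer (GL (Fin 2) R) (![1, 0] : Fin 2 → R)).index = _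
  rw [MulAction.index_stabilizer, ← Nat.card_coe_set_eq]
  refine Nat.card_congr ((finTwoArrowEquiv R).subtypeEquiv fun v => ?_)
  change (∃ M : GL (Fin 2) R, (M : Matrix (Fin 2) (Fin 2) R) *ᵥ ![1, 0] = v) ↔
    IsCoprime (v 0) (v 1)
  constructor
  · rintro ⟨M, rfl⟩
    obtain ⟨u, hu⟩ := M.isUnit.map Matrix.detMonoidHom
    rw [mulVec_one_zero]
    refine ⟨↑u⁻¹ * (M : Matrix (Fin 2) (Fin 2) R) 1 1,
      -(↑u⁻¹ * (M : Matrix (Fin 2) (Fin 2) R) 0 1), ?_⟩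
    have hd : (u : R) = (M : Matrix (Fin 2) (Fin 2) R).det := hu
    rw [Matrix.det_fin_two] at hd
    have h := u.inv_mul
    rw [hd] at h
    simp only [Matrix.cons_val_zero, Matrix.cons_val_one]
    linear_combination h
  · rintro ⟨a, b, h⟩
    have hd : (!![v 0, -b; v 1, a] : Matrix (Fin 2) (Fin 2) R).det = 1 := by
      rw [Matrix.det_fin_two_of]
      linear_combination h
    refine ⟨Matrix.GeneralLinearGroup.mk'' _ (by rw [hd]; exact isUnit_one), ?_⟩
    change (!![v 0, -b; v 1, a] : Matrix (Fin 2) (Fin 2) R) *ᵥ ![1, 0] = v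
    rw [mulVec_one_zero]
    ext i
    fin_cases i <;> simp

theorem index_mul_card_units {R : Type*} [CommRing R] (B : Subgroup (GL (Fin 2) R))
    (hB : ∀ M, M ∈ B ↔ (M : Matrix (Fin 2) (Fin 2) R) 1 0 = 0) :
    B.index * Nat.card Rˣ = Nat.card {v : R × R // IsCoprime v.1 v.2} := by
  have hle : firstColumnStabilizer R ≤ B := fun M hM =>
    (hB M).2 (mem_firstColumnStabilizer.1 hM).2
  let g : B →* R :=
    { toFun := fun M => ((M : GL (Fin 2) R) : Matrix (Fin 2) (Fin 2) R) 0 0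
      map_one' := by simp
      map_mul' := fun M N => by
        have := (hB N).1 N.2
        simp [Matrix.mul_apply, this] }
  let f : B →* Rˣ := g.toHomUnits
  have hker : f.ker = (firstColumnStabilizer R).subgroupOf B := by
    ext M
    rw [MonoidHom.mem_ker, Subgroup.mem_subgroupOf, mem_firstColumnStabilizer, Units.ext_iff]
    exact ⟨fun h => ⟨h, (hB M).1 M.2⟩, fun h => h.1⟩
  have hsurj : Function.Surjective f := by
    intro u
    have hd : IsUnit (!![(u : R), 0; 0, 1] : Matrix (Fin 2) (Fin 2) R).det := by
      simp [Matrix.det_fin_two_of]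
    refine ⟨⟨Matrix.GeneralLinearGroup.mk'' _ hd, (hB _).2 ?_⟩, Units.ext ?_⟩ <;> rfl
  rw [← index_firstColumnStabilizer, ← Subgroup.relIndex_mul_index hle, Subgroup.relIndex,
    ← hker, Subgroup.index_ker, MonoidHom.range_eq_top.2 hsurj, Subgroup.card_top, mul_comm]

theorem card_isCoprime_congr {R S : Type*} [CommRing R] [CommRing S] (e : R ≃+* S) :
    Nat.card {v : R × R // IsCoprime v.1 v.2} = Nat.card {v : S × S // IsCoprime v.1 v.2} := by
  refine Nat.card_congr ((e.toEquiv.prodCongr e.toEquiv).subtypeEquiv fun v => ?_)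
  refine ⟨fun h => h.map e.toRingHom, fun h => ?_⟩
  simpa using h.map e.symm.toRingHom

theorem isCoprime_prod_iff {R S : Type*} [CommRing R] [CommRing S] {x y : R × S} :
    IsCoprime x y ↔ IsCoprime x.1 y.1 ∧ IsCoprime x.2 y.2 := by
  constructor
  · exact fun h => ⟨h.map (RingHom.fst R S), h.map (RingHom.snd R S)⟩
  · rintro ⟨⟨a, b, h⟩, ⟨c, d, h'⟩⟩
    exact ⟨(a, c), (b, d), Prod.ext h h'⟩

theorem card_isCoprime_prod (R S : Type*) [CommRing R] [CommRing S] :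
    Nat.card {v : (R × S) × (R × S) // IsCoprime v.1 v.2} =
      Nat.card {v : R × R // IsCoprime v.1 v.2} * Nat.card {v : S × S // IsCoprime v.1 v.2} := by
  rw [← Nat.card_prod]
  refine Nat.card_congr (((Equiv.prodProdProdComm R S R S).subtypeEquiv fun v => ?_).trans
    (Equiv.subtypeProdEquivProd (p := fun v : R × R => IsCoprime v.1 v.2)
      (q := fun v : S × S => IsCoprime v.1 v.2)))
  exact isCoprime_prod_iff

theorem IsLocalRing.isCoprime_iff {R : Type*} [CommRing R] [IsLocalRing R] {a b : R} :
    IsCoprime a b ↔ IsUnit a ∨ IsUnit b := by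
  constructor
  · rintro ⟨x, y, h⟩
    rcases IsLocalRing.isUnit_or_isUnit_of_add_one h with h | h
    · exact .inl (isUnit_of_mul_isUnit_right h)
    · exact .inr (isUnit_of_mul_isUnit_right h)
  · rintro (⟨u, rfl⟩ | ⟨u, rfl⟩)
    · exact ⟨↑u⁻¹, 0, by simp⟩
    · exact ⟨0, ↑u⁻¹, by simp⟩

theorem card_units_add_card_nonunits (R : Type*) [CommRing R] [Finite R] :
    Nat.card Rˣ + Nat.card {a : R // ¬ IsUnit a} = Nat.card R := by
  classical
  have e : Rˣ ≃ {a : R // IsUnit a} :=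
    Equiv.ofBijective (fun u => ⟨u, u.isUnit⟩)
      ⟨fun u v h => Units.ext (congrArg Subtype.val h), fun ⟨_, u, hu⟩ => ⟨u, Subtype.ext hu⟩⟩
  rw [Nat.card_congr e, ← Nat.card_sum]
  exact Nat.card_congr (Equiv.sumCompl _)

theorem IsLocalRing.card_isCoprime_add (R : Type*) [CommRing R] [IsLocalRing R] [Finite R] :
    Nat.card {v : R × R // IsCoprime v.1 v.2} + Nat.card {a : R // ¬ IsUnit a} ^ 2 =
      Nat.card R ^ 2 := by
  classical
  have h : Nat.card {v : R × R // ¬ IsCoprime v.1 v.2} = Nat.card {a : R // ¬ IsUnit a} ^ 2 := by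
    rw [sq, ← Nat.card_prod]
    refine Nat.card_congr (((Equiv.refl _).subtypeEquiv fun v => ?_).trans
      (Equiv.subtypeProdEquivProd (p := fun a : R => ¬ IsUnit a) (q := fun a : R => ¬ IsUnit a)))
    simp [IsLocalRing.isCoprime_iff]
  rw [← h, ← Nat.card_sum, Nat.card_congr (Equiv.sumCompl _), Nat.card_prod, sq]

theorem ZMod.isLocalRing_prime_pow {p k : ℕ} (hp : p.Prime) (hk : 0 < k) :
    IsLocalRing (ZMod (p ^ k)) := by
  have := Fact.mk hp
  have : Fact (1 < p ^ k) := ⟨Nat.one_lt_pow hk.ne' hp.one_lt⟩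
  exact IsLocalRing.of_surjective' (PadicInt.toZModPow (p := p) k)
    (ZMod.ringHom_surjective _)

theorem ZMod.natCard_units_eq_totient {n : ℕ} (hn : 0 < n) :
    Nat.card (ZMod n)ˣ = n.totient := by
  have : NeZero n := ⟨hn.ne'⟩
  rw [Nat.card_eq_fintype_card, ZMod.card_units_eq_totient]

theorem ZMod.card_isCoprime_mul_prod_primeFactors {n : ℕ} (hn : 0 < n) :
    Nat.card {v : ZMod n × ZMod n // IsCoprime v.1 v.2} * (∏ p ∈ n.primeFactors, p) ^ 2 =
      n ^ 2 * ∏ p ∈ n.primeFactors, (p - 1) * (p + 1) := by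
  induction n using Nat.recOnPosPrimePosCoprime with
  | zero => exact absurd hn (lt_irrefl 0)
  | one =>
    have : Nat.card {v : ZMod 1 × ZMod 1 // IsCoprime v.1 v.2} = 1 :=
      Nat.card_eq_one_iff_unique.2
        ⟨inferInstance, ⟨⟨(0, 0), ⟨0, 0, Subsingleton.elim _ _⟩⟩⟩⟩
    simp [this]
  | prime_pow p k hp hk =>
    have := ZMod.isLocalRing_prime_pow hp hk
    have : NeZero (p ^ k) := ⟨hn.ne'⟩
    obtain ⟨k, rfl⟩ := Nat.exists_eq_succ_of_ne_zero hk.ne'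
    obtain ⟨q, rfl⟩ := Nat.exists_eq_succ_of_ne_zero hp.ne_zero
    have h₁ := card_units_add_card_nonunits (ZMod ((q + 1) ^ (k + 1)))
    have h₂ := IsLocalRing.card_isCoprime_add (ZMod ((q + 1) ^ (k + 1)))
    rw [ZMod.natCard_units_eq_totient hn, Nat.totient_prime_pow_succ hp, Nat.card_zmod,
      Nat.succ_eq_add_one, Nat.add_sub_cancel] at h₁
    have h₃ : Nat.card {a : ZMod ((q + 1) ^ (k + 1)) // ¬ IsUnit a} = (q + 1) ^ k := by
      have : (q + 1) ^ (k + 1) = (q + 1) ^ k * q + (q + 1) ^ k := by ring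
      omega
    rw [h₃, Nat.card_zmod] at h₂
    rw [Nat.primeFactors_prime_pow hk.ne' hp, Finset.prod_singleton, Finset.prod_singleton]
    simp only [Nat.succ_eq_add_one, Nat.add_sub_cancel]
    zify at h₂ ⊢
    linear_combination ((q : ℤ) + 1) ^ 2 * h₂
  | coprime a b ha hb hab iha ihb =>
    rw [card_isCoprime_congr (ZMod.chineseRemainder hab), card_isCoprime_prod,
      hab.primeFactors_mul, Finset.prod_union hab.disjoint_primeFactors,
      Finset.prod_union hab.disjoint_primeFactors]
    have h := congrArg₂ (· * ·) (iha (by omega)) (ihb (by omega))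
    beta_reduce at h
    linear_combination h

/-- For a positive integer `n`, the index of the subgroup `B(n)` of upper-triangular matrices
in `GL₂(ℤ/nℤ)` satisfies `[GL₂(ℤ/nℤ) : B(n)] * ∏_{p ∣ n} p = n * ∏_{p ∣ n} (p + 1)`, i.e.
`[GL₂(ℤ/nℤ) : B(n)] = n * ∏_{p ∣ n} (1 + 1/p)`, the degree of the map `X₀(n) → X₀(1)`. -/
theorem index_upperTriangular_subgroup (n : ℕ) (hn : 0 < n)
    (B : Subgroup (GL (Fin 2) (ZMod n)))
    (hB : (B : Set (GL (Fin 2) (ZMod n))) =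
      {M : GL (Fin 2) (ZMod n) | (M : Matrix (Fin 2) (Fin 2) (ZMod n)) 1 0 = 0}) :
    B.index * ∏ p ∈ n.primeFactors, p = n * ∏ p ∈ n.primeFactors, (p + 1) := by
  have h₁ := index_mul_card_units B fun M => Set.ext_iff.1 hB M
  have h₂ := ZMod.card_isCoprime_mul_prod_primeFactors hn
  have h₃ := Nat.totient_mul_prod_primeFactors n
  rw [ZMod.natCard_units_eq_totient hn] at h₁
  rw [← h₁, Finset.prod_mul_distrib] at h₂
  have hpos : 0 < n * ∏ p ∈ n.primeFactors, (p - 1) :=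
    Nat.mul_pos hn (Finset.prod_pos fun p hp =>
      Nat.sub_pos_of_lt (Nat.prime_of_mem_primeFactors hp).one_lt)
  refine Nat.eq_of_mul_eq_mul_right hpos ?_
  linear_combination h₂ - (B.index * ∏ p ∈ n.primeFactors, p) * h₃
end
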